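/- arXiv:2509.11283 — 2 statements merged into one kernel-verified Lean document; each statement's English description precedes it below -/
import Mathlib

section
/- Let n be an integer, m > 1 and p > 0 real. Let u be a positive C^3 function on an open set U ⊂ ℝ^n with ∇u ≠ 0 on U, satisfying Δ_m u + u^p = 0 in U. Then the following Pohozaev-type pointwise identity holds everywhere in U: ∂_n(|∇u|^m) - m Σ_{i=1}^n ∂_i(|∇u|^{m-2} (∂_i u)(∂_n u)) - (m/(p+1)) ∂_n(u^{p+1}) = 0. -/
open MeasureTheory
open scoped RealInnerProductSpace

noncomputable section

/-- The last coordinate of a point in `EuclideanSpace ℝ (Fin n)`. -/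
def lastC {n : ℕ} (x : EuclideanSpace ℝ (Fin n)) : ℝ :=
  if h : 0 < n then x ⟨n - 1, Nat.sub_lt h Nat.one_pos⟩ else 0

/-- Partial derivative of `f` in the `i`-th coordinate direction. -/
def pd {n : ℕ} (i : Fin n) (f : EuclideanSpace ℝ (Fin n) → ℝ)
    (x : EuclideanSpace ℝ (Fin n)) : ℝ :=
  fderiv ℝ f x (EuclideanSpace.single i 1)

/-- Partial derivative in the last coordinate direction. -/
def pdn {n : ℕ} (f : EuclideanSpace ℝ (Fin n) → ℝ)
    (x : EuclideanSpace ℝ (Fin n)) : ℝ :=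
  if h : 0 < n then pd ⟨n - 1, Nat.sub_lt h Nat.one_pos⟩ f x else 0

/-- The vector field `X = |∇u|^{m-2} ∇u`. -/
def fieldX {n : ℕ} (m : ℝ) (u : EuclideanSpace ℝ (Fin n) → ℝ)
    (x : EuclideanSpace ℝ (Fin n)) : EuclideanSpace ℝ (Fin n) :=
  ‖gradient u x‖ ^ (m - 2) • gradient u x

/-- `X^i_j = ∂_j (|∇u|^{m-2} u_i)`. -/
def Xmat {n : ℕ} (m : ℝ) (u : EuclideanSpace ℝ (Fin n) → ℝ)
    (x : EuclideanSpace ℝ (Fin n)) (i j : Fin n) : ℝ :=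
  pd j (fun y => fieldX m u y i) x

/-- The `m`-Laplacian `Δ_m u = div (|∇u|^{m-2} ∇u)`. -/
def pLap {n : ℕ} (m : ℝ) (u : EuclideanSpace ℝ (Fin n) → ℝ)
    (x : EuclideanSpace ℝ (Fin n)) : ℝ :=
  ∑ i : Fin n, Xmat m u x i i

/-- The open upper half-space `ℝⁿ₊`. -/
def openHalf (n : ℕ) : Set (EuclideanSpace ℝ (Fin n)) := {x | 0 < lastC x}

/-- The closed upper half-space. -/
def closedHalf (n : ℕ) : Set (EuclideanSpace ℝ (Fin n)) := {x | 0 ≤ lastC x}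

/-- The boundary hyperplane `{xₙ = 0}`. -/
def bdry (n : ℕ) : Set (EuclideanSpace ℝ (Fin n)) := {x | lastC x = 0}

section PartialDerivatives

variable {n : ℕ} {x : EuclideanSpace ℝ (Fin n)} {u f g : EuclideanSpace ℝ (Fin n) → ℝ}

lemma gradient_apply_eq_pd (u : EuclideanSpace ℝ (Fin n) → ℝ) (x : EuclideanSpace ℝ (Fin n))
    (i : Fin n) : gradient u x i = pd i u x := by
  have h : ⟪gradient u x, EuclideanSpace.single i (1 : ℝ)⟫ = pd i u x := by
    simp [gradient, pd]
  rw [← h, EuclideanSpace.inner_single_right]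
  simp

lemma norm_gradient_rpow (u : EuclideanSpace ℝ (Fin n) → ℝ) (x : EuclideanSpace ℝ (Fin n))
    (m : ℝ) : ‖gradient u x‖ ^ m = (∑ i, pd i u x ^ 2) ^ (m / 2) := by
  have h : ∑ i, pd i u x ^ 2 = ‖gradient u x‖ ^ (2 : ℝ) := by
    rw [Real.rpow_two, EuclideanSpace.real_norm_sq_eq]
    simp only [gradient_apply_eq_pd]
  rw [h, ← Real.rpow_mul (norm_nonneg _)]
  congr 1
  ring

lemma sum_pd_sq_pos (hx : gradient u x ≠ 0) : 0 < ∑ i, pd i u x ^ 2 := by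
  simp only [← gradient_apply_eq_pd, ← EuclideanSpace.real_norm_sq_eq]
  exact pow_pos (norm_pos_iff.mpr hx) 2

lemma pd_mul (i : Fin n) (hf : DifferentiableAt ℝ f x) (hg : DifferentiableAt ℝ g x) :
    pd i (fun y => f y * g y) x = pd i f x * g x + f x * pd i g x := by
  simp only [pd, fderiv_fun_mul hf hg]
  simp
  ring

lemma pd_rpow_const (i : Fin n) (hf : DifferentiableAt ℝ f x) (hx : 0 < f x) (q : ℝ) :
    pd i (fun y => f y ^ q) x = q * f x ^ (q - 1) * pd i f x := by
  simp only [pd, (hf.hasFDerivAt.rpow_const (p := q) (Or.inl hx.ne')).fderiv]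
  simp

lemma differentiableAt_fderiv (hu : ContDiffAt ℝ 2 u x) : DifferentiableAt ℝ (fderiv ℝ u) x :=
  (hu.fderiv_right (m := 1) (by norm_num)).differentiableAt (by norm_num)

lemma differentiableAt_pd (i : Fin n) (hu : ContDiffAt ℝ 2 u x) :
    DifferentiableAt ℝ (pd i u) x :=
  (differentiableAt_fderiv hu).clm_apply (differentiableAt_const _)

lemma pd_comm (i j : Fin n) (hu : ContDiffAt ℝ 2 u x) :
    pd i (pd j u) x = pd j (pd i u) x := by
  have h : ∀ i j : Fin n, pd i (pd j u) x =
      fderiv ℝ (fderiv ℝ u) x (EuclideanSpace.single i 1) (EuclideanSpace.single j 1) := by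
    intro i j
    change fderiv ℝ (fun y => fderiv ℝ u y (EuclideanSpace.single j 1)) x _ = _
    rw [fderiv_clm_apply (differentiableAt_fderiv hu) (differentiableAt_const _)]
    simp
  rw [h, h]
  exact hu.isSymmSndFDerivAt (by simp) _ _

lemma differentiableAt_norm_gradient_rpow (hu : ContDiffAt ℝ 2 u x) (hx : gradient u x ≠ 0)
    (q : ℝ) : DifferentiableAt ℝ (fun y => ‖gradient u y‖ ^ q) x := by
  simp only [norm_gradient_rpow]
  exact (DifferentiableAt.fun_sum fun i _ => (differentiableAt_pd i hu).pow 2).rpow_const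
    (Or.inl (sum_pd_sq_pos hx).ne')

lemma pd_norm_gradient_rpow (k : Fin n) (hu : ContDiffAt ℝ 2 u x) (hx : gradient u x ≠ 0)
    (m : ℝ) :
    pd k (fun y => ‖gradient u y‖ ^ m) x =
      m * ‖gradient u x‖ ^ (m - 2) * ∑ i, pd i u x * pd k (pd i u) x := by
  have hd : ∀ i ∈ Finset.univ, DifferentiableAt ℝ (fun y => pd i u y ^ 2) x :=
    fun i _ => (differentiableAt_pd i hu).pow 2
  have hsum : pd k (fun y => ∑ i, pd i u y ^ 2) x = 2 * ∑ i, pd i u x * pd k (pd i u) x := by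
    have hsq : ∀ i, pd k (fun y => pd i u y ^ 2) x = 2 * (pd i u x * pd k (pd i u) x) := by
      intro i
      simp only [sq]
      rw [pd_mul k (differentiableAt_pd i hu) (differentiableAt_pd i hu)]
      ring
    rw [Finset.mul_sum, ← Finset.sum_congr rfl fun i _ => hsq i]
    simp only [pd] at hd ⊢
    rw [fderiv_fun_sum hd]
    simp
  simp only [norm_gradient_rpow]
  rw [pd_rpow_const k (DifferentiableAt.fun_sum hd) (sum_pd_sq_pos hx), hsum,
    show m / 2 - 1 = (m - 2) / 2 by ring]
  ring

lemma sum_pd_field_mul (k : Fin n) (m : ℝ) (hu : ContDiffAt ℝ 2 u x) (hx : gradient u x ≠ 0) :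
    ∑ i, pd i (fun y => ‖gradient u y‖ ^ (m - 2) * pd i u y * pd k u y) x =
      pLap m u x * pd k u x
        + ‖gradient u x‖ ^ (m - 2) * ∑ i, pd i u x * pd k (pd i u) x := by
  rw [pLap, Finset.sum_mul, Finset.mul_sum, ← Finset.sum_add_distrib]
  refine Finset.sum_congr rfl fun i _ => ?_
  rw [pd_mul i ((differentiableAt_norm_gradient_rpow hu hx _).fun_mul (differentiableAt_pd i hu))
    (differentiableAt_pd k hu), pd_comm i k hu]
  simp only [Xmat, fieldX, PiLp.smul_apply, smul_eq_mul, gradient_apply_eq_pd]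
  ring

end PartialDerivatives

/-- **Pohozaev-type pointwise identity.** For a positive `C³` solution of
`Δ_m u + u^p = 0` on an open set `U` with nonvanishing gradient,
`∂ₙ(|∇u|^m) - m ∑ᵢ ∂ᵢ(|∇u|^{m-2} uᵢ uₙ) - (m/(p+1)) ∂ₙ(u^{p+1}) = 0` in `U`. -/
theorem pohozaev_pointwise_identity
    (n : ℕ) (m p : ℝ) (hm : 1 < m) (hp : 0 < p)
    (U : Set (EuclideanSpace ℝ (Fin n))) (hU : IsOpen U)
    (u : EuclideanSpace ℝ (Fin n) → ℝ)
    (hC3 : ContDiffOn ℝ 3 u U)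
    (hpos : ∀ x ∈ U, 0 < u x)
    (hgrad : ∀ x ∈ U, gradient u x ≠ 0)
    (heq : ∀ x ∈ U, pLap m u x + u x ^ p = 0) :
    ∀ x ∈ U,
      pdn (fun y => ‖gradient u y‖ ^ m) x
        - m * ∑ i : Fin n,
            pd i (fun y => ‖gradient u y‖ ^ (m - 2) * pd i u y * pdn u y) x
        - (m / (p + 1)) * pdn (fun y => u y ^ (p + 1)) x = 0 := by
  intro x hx
  rcases Nat.eq_zero_or_pos n with rfl | hn
  · simp [pdn]
  have hu : ContDiffAt ℝ 2 u x := (hC3.contDiffAt (hU.mem_nhds hx)).of_le (by norm_num)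
  simp only [pdn, dif_pos hn]
  rw [pd_norm_gradient_rpow _ hu (hgrad x hx), sum_pd_field_mul _ m hu (hgrad x hx),
    pd_rpow_const _ (hu.differentiableAt (by norm_num)) (hpos x hx),
    eq_neg_of_add_eq_zero_left (heq x hx), add_sub_cancel_right]
  have hp' : p + 1 ≠ 0 := by positivity
  field_simp
  ring
end
end

section
/- Let m, n, p, q be real numbers with 1 < m < n. Assume n(m-1)/(n-m) ≤ p ≤ nm/(n-m) - 1, (n-1)(m-1)/(n-m) ≤ q ≤ n(m-1)/(n-m), and (q+1)/(p+1) > (n-1)/n. Then q^2 - (1/m - 2/n) q - (1 + 1/m - 2/n) p q + ((m-1)/m)(p + 1) > 0. -/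
/-- The hyperbola inequality (3.11) holds in the region between the Serrin and Sobolev
indices above the line `(q+1)/(p+1) = (n-1)/n`. -/
theorem hyperbola_inequality_case1 (m n p q : ℝ) (hm : 1 < m) (hmn : m < n)
    (hp1 : n * (m - 1) / (n - m) ≤ p) (hp2 : p ≤ n * m / (n - m) - 1)
    (hq1 : (n - 1) * (m - 1) / (n - m) ≤ q) (hq2 : q ≤ n * (m - 1) / (n - m))
    (hline : (q + 1) / (p + 1) > (n - 1) / n) :
    q ^ 2 - (1 / m - 2 / n) * q - (1 + 1 / m - 2 / n) * p * q
      + ((m - 1) / m) * (p + 1) > 0 := by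
  have hm0 : 0 < m := by linarith
  have hn0 : 0 < n := by linarith
  have hn1 : 0 < n - 1 := by linarith
  have hnm : 0 < n - m := by linarith
  have hq : 0 < q :=
    (div_pos (mul_pos hn1 (sub_pos.2 hm)) hnm).trans_le hq1
  have hp : 0 < p :=
    (div_pos (mul_pos hn0 (sub_pos.2 hm)) hnm).trans_le hp1
  have hline' : (n - 1) * (p + 1) < (q + 1) * n :=
    (div_lt_div_iff₀ hn0 (by linarith)).1 hline
  have hq2' : q * (n - m) ≤ n * (m - 1) := (le_div_iff₀ hnm).1 hq2
  -- The left-hand side is affine in `p + 1`, with slope `-c`.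
  set c := (1 + 1 / m - 2 / n) * q - (m - 1) / m with hc
  have hF : q ^ 2 - (1 / m - 2 / n) * q - (1 + 1 / m - 2 / n) * p * q
      + ((m - 1) / m) * (p + 1) = q * (q + 1) - (p + 1) * c := by
    rw [hc]; ring
  rw [hF]
  rcases le_or_gt c 0 with hc0 | hc0
  · nlinarith [mul_pos hq (add_pos hq one_pos),
      mul_nonneg (add_pos hp one_pos).le (neg_nonneg.2 hc0)]
  · have hcq : 0 ≤ (n - 1) * q - n * c := by
      have h : (n - 1) * q - n * c = (n * (m - 1) - q * (n - m)) / m := by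
        rw [hc]; field_simp; ring
      rw [h]
      exact div_nonneg (sub_nonneg.2 hq2') hm0.le
    have hpos : 0 < (n - 1) * (q * (q + 1) - (p + 1) * c) := by
      linear_combination mul_lt_mul_of_pos_right hline' hc0 +
        mul_nonneg (add_pos hq one_pos).le hcq
    exact pos_of_mul_pos_right hpos hn1.le
end
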